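/- Let n ≥ 2, let P be a lattice polytope in ℝⁿ of affine dimension n, let L be a lattice polytope of affine dimension 1 (a segment), and let Q₁,…,Q_l be lattice polytopes each of affine dimension n such that P + L = convexHull ℝ (⋃_{j=1}^l Q_j). Then the sequence (Q₁,…,Q_l,P) is not a regular sequence: L + P ∈ C(Q₁,…,Q_l) but L ∉ C(Q₁,…,Q_l). -/

import Mathlib

open Pointwise

/-- A lattice polytope in `ℝⁿ`: the convex hull of a nonempty finite set of points
all of whose coordinates are nonnegative integers. -/
def IsLatticePolytope {n : ℕ} (P : Set (Fin n → ℝ)) : Prop :=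
  ∃ F : Finset (Fin n → ℝ), F.Nonempty ∧ (∀ x ∈ F, ∀ i, ∃ m : ℕ, x i = (m : ℝ)) ∧
    P = convexHull ℝ (F : Set (Fin n → ℝ))

/-- The affine dimension of a subset of `ℝⁿ`: the dimension of the direction of its
affine span. -/
noncomputable def affDim {n : ℕ} (P : Set (Fin n → ℝ)) : ℕ :=
  Module.finrank ℝ (affineSpan ℝ P).direction

/-- The sub-semimodule generated by a collection `S` of lattice polytopes. -/
def CSub {n : ℕ} (S : Set (Set (Fin n → ℝ))) : Set (Set (Fin n → ℝ)) :=
  {P | ∃ (J : Finset ℕ) (A B : ℕ → Set (Fin n → ℝ)), J.Nonempty ∧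
    (∀ j ∈ J, IsLatticePolytope (A j) ∧ B j ∈ S) ∧
    P = convexHull ℝ (⋃ j ∈ J, (A j + B j))}

theorem isLatticePolytope_zero {n : ℕ} : IsLatticePolytope ({0} : Set (Fin n → ℝ)) :=
  ⟨{0}, Finset.singleton_nonempty 0, fun x hx i => ⟨0, by simp_all⟩, by simp⟩

theorem IsLatticePolytope.nonempty {n : ℕ} {P : Set (Fin n → ℝ)} (hP : IsLatticePolytope P) :
    P.Nonempty := by
  obtain ⟨F, hF, -, rfl⟩ := hP
  exact (Finset.coe_nonempty.mpr hF).convexHull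

/-- The affine dimension of a Minkowski summand of a subset of `L` is at most that of `L`. -/
theorem affDim_le_of_add_subset {n : ℕ} {A Q L : Set (Fin n → ℝ)} (hA : A.Nonempty)
    (h : A + Q ⊆ L) : affDim Q ≤ affDim L := by
  obtain ⟨a, ha⟩ := hA
  unfold affDim
  rw [direction_affineSpan, direction_affineSpan]
  refine Submodule.finrank_mono (Submodule.span_le.mpr ?_)
  rintro _ ⟨x, hx, y, hy, rfl⟩
  have := vsub_mem_vectorSpan ℝ (h (Set.add_mem_add ha hx)) (h (Set.add_mem_add ha hy))
  simpa using this

/-- The convex hull of a nonempty finite family is in the sub-semimodule it generates. -/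
theorem convexHull_iUnion_mem_CSub {n l : ℕ} (hl : 0 < l) (Q : Fin l → Set (Fin n → ℝ)) :
    convexHull ℝ (⋃ j, Q j) ∈ CSub {S | ∃ j : Fin l, S = Q j} := by
  refine ⟨Finset.range l, fun _ => {0}, fun j => if h : j < l then Q ⟨j, h⟩ else ∅,
    ⟨0, Finset.mem_range.mpr hl⟩, fun j hj => ?_, ?_⟩
  · have h := Finset.mem_range.mp hj
    exact ⟨isLatticePolytope_zero, ⟨j, h⟩, by simp [h]⟩
  · congr 1
    ext x
    simp only [Set.mem_iUnion, Set.singleton_add, zero_add, Set.image_id', Finset.mem_range,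
      exists_prop]
    constructor
    · rintro ⟨j, hj⟩
      exact ⟨j, j.2, by simpa using hj⟩
    · rintro ⟨j, h, hj⟩
      exact ⟨⟨j, h⟩, by simpa [h] using hj⟩

/-- If a full-dimensional lattice polytope `P` times a segment `L` is decomposed as the
convex hull of full-dimensional polytopes `Q₁, …, Q_l`, then `(Q₁, …, Q_l, P)` is not a
regular sequence: `L ⊙ P ∈ C(Q₁, …, Q_l)` but `L ∉ C(Q₁, …, Q_l)`. -/
theorem full_dim_times_segment_not_regular {n : ℕ} (hn : 2 ≤ n)
    (P L : Set (Fin n → ℝ)) (hP : IsLatticePolytope P) (hL : IsLatticePolytope L)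
    (hPdim : affDim P = n) (hLdim : affDim L = 1)
    (l : ℕ) (hl : 0 < l) (Q : Fin l → Set (Fin n → ℝ))
    (hQ : ∀ j, IsLatticePolytope (Q j)) (hQdim : ∀ j, affDim (Q j) = n)
    (hdecomp : P + L = convexHull ℝ (⋃ j, Q j)) :
    L + P ∈ CSub {S | ∃ j : Fin l, S = Q j} ∧
      L ∉ CSub {S | ∃ j : Fin l, S = Q j} := by
  refine ⟨?_, ?_⟩
  · rw [add_comm, hdecomp]
    exact convexHull_iUnion_mem_CSub hl Q
  · rintro ⟨J, A, B, ⟨j, hj⟩, hAB, hLeq⟩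
    obtain ⟨hA, k, hk⟩ := hAB j hj
    have hsub : A j + Q k ⊆ L := by
      rw [hLeq, ← hk]
      exact (Set.subset_biUnion_of_mem (u := fun j => A j + B j) hj).trans
        (subset_convexHull ℝ _)
    have := affDim_le_of_add_subset hA.nonempty hsub
    rw [hQdim, hLdim] at this
    omega
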